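/- (Effective Vitali covering, corollary) Under the hypotheses of the effective Vitali covering theorem (group Γ of polynomial growth of degree d, constants C, c := 3^dC², balls A₁(p) ⊆ … ⊆ A_n(p) ⊆ B(R) with r-enlargement nesting, S_i := ⋃_p A_i(p)), assume additionally |S_n| ≤ (c+1)|S₁|. Then there is a pairwise disjoint subcollection 𝒞 of maximal balls such that the union of the (1 + 4/(r−2))-enlargements of balls in 𝒞 covers at least a (1 − (c+1)((c−1)/c)^n)-fraction of S₁. -/

import Mathlib

open Filter MeasureTheory Function Set
open scoped BigOperators

variable {Γ : Type*} [Group Γ]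

/-- The word norm associated to a finite generating set `S`:
the infimum of `Σ |pᵢ|` over all representations `γ = s₁^{p₁} ⋯ s_l^{p_l}` with `sᵢ ∈ S`. -/
noncomputable def wordNorm (S : Finset Γ) (γ : Γ) : ℕ :=
  sInf {n | ∃ l : List (Γ × ℤ), (∀ p ∈ l, p.1 ∈ S) ∧
    (l.map fun p => p.1 ^ p.2).prod = γ ∧ (l.map fun p => p.2.natAbs).sum = n}

/-- Closed ball of radius `r` around `x` for the right word metric `d_R(x,y) = ‖x y⁻¹‖`. -/
def wordBall (S : Finset Γ) (x : Γ) (r : ℝ) : Set Γ :=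
  {y | (wordNorm S (x * y⁻¹) : ℝ) ≤ r}

theorem exists_list_wordNorm {S : Finset Γ} (hS : Subgroup.closure (S : Set Γ) = ⊤) (γ : Γ) :
    ∃ l : List (Γ × ℤ), (∀ p ∈ l, p.1 ∈ S) ∧
      (l.map fun p => p.1 ^ p.2).prod = γ ∧ (l.map fun p => p.2.natAbs).sum = wordNorm S γ := by
  refine Nat.sInf_mem (s := {n | ∃ l : List (Γ × ℤ), (∀ p ∈ l, p.1 ∈ S) ∧
    (l.map fun p => p.1 ^ p.2).prod = γ ∧ (l.map fun p => p.2.natAbs).sum = n}) ?_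
  suffices h : ∃ l : List (Γ × ℤ), (∀ p ∈ l, p.1 ∈ S) ∧ (l.map fun p => p.1 ^ p.2).prod = γ by
    obtain ⟨l, h₁, h₂⟩ := h
    exact ⟨_, l, h₁, h₂, rfl⟩
  have hγ : γ ∈ Subgroup.closure (S : Set Γ) := hS ▸ Subgroup.mem_top γ
  induction hγ using Subgroup.closure_induction with
  | mem x hx => exact ⟨[(x, 1)], by simpa using hx, by simp⟩
  | one => exact ⟨[], by simp, by simp⟩
  | mul x y _ _ hx hy =>
    obtain ⟨l, h₁, h₂⟩ := hx
    obtain ⟨m, h₃, h₄⟩ := hy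
    refine ⟨l ++ m, fun p hp => ?_, by simp [h₂, h₄]⟩
    exact (List.mem_append.1 hp).elim (h₁ p) (h₃ p)
  | inv x _ hx =>
    obtain ⟨l, h₁, h₂⟩ := hx
    refine ⟨(l.map fun p => (p.1, -p.2)).reverse, fun p hp => ?_, ?_⟩
    · obtain ⟨q, hq, rfl⟩ := List.mem_map.1 (List.mem_reverse.1 hp)
      exact h₁ q hq
    · rw [← h₂, List.prod_inv_reverse]
      simp [List.map_reverse, Function.comp_def]

theorem wordNorm_list_le {S : Finset Γ} {l : List (Γ × ℤ)} (hl : ∀ p ∈ l, p.1 ∈ S) :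
    wordNorm S (l.map fun p => p.1 ^ p.2).prod ≤ (l.map fun p => p.2.natAbs).sum :=
  Nat.sInf_le ⟨l, hl, rfl, rfl⟩

theorem wordNorm_mul_le {S : Finset Γ} (hS : Subgroup.closure (S : Set Γ) = ⊤) (g h : Γ) :
    wordNorm S (g * h) ≤ wordNorm S g + wordNorm S h := by
  obtain ⟨l, h₁, h₂, h₃⟩ := exists_list_wordNorm hS g
  obtain ⟨m, h₄, h₅, h₆⟩ := exists_list_wordNorm hS h
  have := wordNorm_list_le (S := S) (l := l ++ m)
    fun p hp => (List.mem_append.1 hp).elim (h₁ p) (h₄ p)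
  simpa [h₂, h₃, h₅, h₆] using this

theorem wordNorm_inv_le {S : Finset Γ} (hS : Subgroup.closure (S : Set Γ) = ⊤) (g : Γ) :
    wordNorm S g⁻¹ ≤ wordNorm S g := by
  obtain ⟨l, h₁, h₂, h₃⟩ := exists_list_wordNorm hS g
  have := wordNorm_list_le (S := S) (l := (l.map fun p => (p.1, -p.2)).reverse) fun p hp => by
    obtain ⟨q, hq, rfl⟩ := List.mem_map.1 (List.mem_reverse.1 hp)
    exact h₁ q hq
  rw [← h₃, ← h₂, List.prod_inv_reverse]
  simpa [List.map_reverse, Function.comp_def] using this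

theorem wordNorm_inv {S : Finset Γ} (hS : Subgroup.closure (S : Set Γ) = ⊤) (g : Γ) :
    wordNorm S g⁻¹ = wordNorm S g :=
  (wordNorm_inv_le hS g).antisymm (by simpa using wordNorm_inv_le hS g⁻¹)

theorem wordNorm_mul_inv_comm {S : Finset Γ} (hS : Subgroup.closure (S : Set Γ) = ⊤) (x y : Γ) :
    wordNorm S (x * y⁻¹) = wordNorm S (y * x⁻¹) := by
  rw [← wordNorm_inv hS]
  simp

theorem wordNorm_mul_inv_triangle {S : Finset Γ} (hS : Subgroup.closure (S : Set Γ) = ⊤)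
    (x y z : Γ) :
    wordNorm S (x * z⁻¹) ≤ wordNorm S (x * y⁻¹) + wordNorm S (y * z⁻¹) := by
  simpa using wordNorm_mul_le hS (x * y⁻¹) (y * z⁻¹)

theorem wordBall_mono (S : Finset Γ) (x : Γ) {a b : ℝ} (h : a ≤ b) :
    wordBall S x a ⊆ wordBall S x b :=
  fun _ hy => le_trans hy h

theorem radius_nonneg_of_mem_wordBall {S : Finset Γ} {x y : Γ} {a : ℝ}
    (h : y ∈ wordBall S x a) : 0 ≤ a :=
  le_trans (Nat.cast_nonneg _) h

theorem wordBall_natFloor (S : Finset Γ) (x : Γ) {a : ℝ} (ha : 0 ≤ a) :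
    wordBall S x (⌊a⌋₊ : ℝ) = wordBall S x a := by
  ext y
  simp [wordBall, Nat.le_floor_iff ha]

theorem wordBall_subset_of_inter_nonempty {S : Finset Γ}
    (hS : Subgroup.closure (S : Set Γ) = ⊤) {x y : Γ} {a b e : ℝ}
    (h : (wordBall S x a ∩ wordBall S y b).Nonempty) (he : a + 2 * b ≤ e) :
    wordBall S y b ⊆ wordBall S x e := by
  obtain ⟨z, hz₁, hz₂⟩ := h
  intro w hw
  have h₁ : (wordNorm S (x * w⁻¹) : ℝ) ≤ wordNorm S (x * z⁻¹) + wordNorm S (z * w⁻¹) := by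
    exact_mod_cast wordNorm_mul_inv_triangle hS x z w
  have h₂ : (wordNorm S (z * w⁻¹) : ℝ) ≤ wordNorm S (z * y⁻¹) + wordNorm S (y * w⁻¹) := by
    exact_mod_cast wordNorm_mul_inv_triangle hS z y w
  rw [wordNorm_mul_inv_comm hS z y] at h₂
  simp only [wordBall, mem_ofPred_eq] at hz₁ hz₂ hw ⊢
  linarith

theorem wordBall_eq_image (S : Finset Γ) (x : Γ) (a : ℝ) :
    wordBall S x a = (· * x) '' wordBall S 1 a := by
  ext y
  simp [wordBall, image_mul_right]

theorem ncard_wordBall (S : Finset Γ) (x : Γ) (a : ℝ) :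
    (wordBall S x a).ncard = (wordBall S 1 a).ncard := by
  rw [wordBall_eq_image, ncard_image_of_injective _ (mul_left_injective x)]

theorem ncard_wordBall_three_mul_le {S : Finset Γ} {d : ℕ} {C : ℝ} (hC : 1 ≤ C)
    (hgr : ∀ m : ℕ, 1 ≤ m →
      (1 / C) * (m : ℝ) ^ d ≤ ((wordBall S 1 (m : ℝ)).ncard : ℝ) ∧
      ((wordBall S 1 (m : ℝ)).ncard : ℝ) ≤ C * (m : ℝ) ^ d) (x : Γ) (m : ℕ) :
    ((wordBall S x ((3 * m : ℕ) : ℝ)).ncard : ℝ) ≤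
      3 ^ d * C ^ 2 * ((wordBall S x (m : ℝ)).ncard : ℝ) := by
  rw [ncard_wordBall S x, ncard_wordBall S x]
  rcases Nat.eq_zero_or_pos m with rfl | hm
  · have : (1 : ℝ) ≤ 3 ^ d * C ^ 2 :=
      one_le_mul_of_one_le_of_one_le (one_le_pow₀ (by norm_num)) (one_le_pow₀ hC)
    simpa using le_mul_of_one_le_left (Nat.cast_nonneg _) this
  · calc ((wordBall S 1 ((3 * m : ℕ) : ℝ)).ncard : ℝ)
        ≤ C * ((3 * m : ℕ) : ℝ) ^ d := (hgr (3 * m) (by omega)).2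
      _ = 3 ^ d * C ^ 2 * ((1 / C) * (m : ℝ) ^ d) := by
        push_cast
        rw [mul_pow]
        field_simp
      _ ≤ _ := by
        gcongr
        exact (hgr m hm).1

/-- Greedy selection: a finite family of nonempty sets, each with a size, has a disjoint subfamily
such that every set of the family meets a selected set of at least its size. -/
theorem exists_disjoint_subfamily_meeting {ι α : Type*} (B : ι → Set α) (δ : ι → ℕ)
    (t : Finset ι) (hne : ∀ a ∈ t, (B a).Nonempty) :
    ∃ u ⊆ t, (u : Set ι).PairwiseDisjoint B ∧
      ∀ a ∈ t, ∃ b ∈ u, (B b ∩ B a).Nonempty ∧ δ a ≤ δ b := by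
  classical
  induction t using Finset.strongInduction with
  | H t ih =>
    rcases t.eq_empty_or_nonempty with rfl | ht
    · exact ⟨∅, by simp⟩
    obtain ⟨m, hm, hmax⟩ := t.exists_max_image δ ht
    have hmm : ¬ Disjoint (B m) (B m) := by
      rw [disjoint_self]
      exact (hne m hm).ne_empty
    obtain ⟨u, hut, hdisj, hu⟩ := ih (t.filter fun a => Disjoint (B m) (B a))
      (Finset.filter_ssubset.2 ⟨m, hm, hmm⟩) fun a ha => hne a (Finset.mem_filter.1 ha).1
    refine ⟨insert m u, Finset.insert_subset hm (hut.trans (Finset.filter_subset _ _)), ?_, ?_⟩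
    · rw [Finset.coe_insert]
      exact hdisj.insert fun b hb _ => (Finset.mem_filter.1 (hut hb)).2
    · intro a ha
      by_cases h : Disjoint (B m) (B a)
      · obtain ⟨b, hb, hab⟩ := hu a (Finset.mem_filter.2 ⟨ha, h⟩)
        exact ⟨b, Finset.mem_insert_of_mem hb, hab⟩
      · exact ⟨m, Finset.mem_insert_self _ _, Set.not_disjoint_iff_nonempty_inter.1 h, hmax a ha⟩

/-- In a finite family whose sets have enlargements `T` of at most `c` times their cardinality,
some disjoint subfamily leaves uncovered at most a `(c - 1) / c`-fraction of the union. -/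
theorem exists_disjoint_subfamily_ncard_diff_le {ι α : Type*} (B T : ι → Set α) (δ : ι → ℕ)
    {c : ℝ} (hc : 1 ≤ c) (t : Finset ι) (hne : ∀ a ∈ t, (B a).Nonempty)
    (hfin : ∀ a ∈ t, (B a).Finite) (hTfin : ∀ a ∈ t, (T a).Finite)
    (hT : ∀ a ∈ t, ∀ b ∈ t, (B b ∩ B a).Nonempty → δ a ≤ δ b → B a ⊆ T b)
    (hcard : ∀ a ∈ t, ((T a).ncard : ℝ) ≤ c * (B a).ncard) :
    ∃ u ⊆ t, (u : Set ι).PairwiseDisjoint B ∧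
      (((⋃ a ∈ t, B a) \ ⋃ a ∈ u, B a).ncard : ℝ) ≤
        (c - 1) / c * (⋃ a ∈ t, B a).ncard := by
  obtain ⟨u, hut, hdisj, hu⟩ := exists_disjoint_subfamily_meeting B δ t hne
  refine ⟨u, hut, hdisj, ?_⟩
  have hsub : (⋃ a ∈ u, B a) ⊆ ⋃ a ∈ t, B a := biUnion_subset_biUnion_left hut
  have htfin : (⋃ a ∈ t, B a).Finite := t.finite_toSet.biUnion hfin
  have hcov : (⋃ a ∈ t, B a) ⊆ ⋃ b ∈ u, T b := by
    refine iUnion₂_subset fun a ha => ?_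
    obtain ⟨b, hb, hab, hle⟩ := hu a ha
    exact (hT a ha b (hut hb) hab hle).trans (subset_biUnion_of_mem (u := T) hb)
  have hle : ((⋃ a ∈ t, B a).ncard : ℝ) ≤ c * (⋃ a ∈ u, B a).ncard := by
    have h₁ : (⋃ a ∈ t, B a).ncard ≤ ∑ b ∈ u, (T b).ncard :=
      (ncard_le_ncard hcov (u.finite_toSet.biUnion fun b hb => hTfin b (hut hb))).trans
        (u.set_ncard_biUnion_le T)
    have h₂ : (⋃ a ∈ u, B a).ncard = ∑ b ∈ u, (B b).ncard := by
      rw [← finsum_mem_coe_finset]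
      exact u.finite_toSet.ncard_biUnion (fun b hb => hfin b (hut hb)) hdisj
    calc ((⋃ a ∈ t, B a).ncard : ℝ) ≤ ∑ b ∈ u, ((T b).ncard : ℝ) := by exact_mod_cast h₁
      _ ≤ ∑ b ∈ u, c * ((B b).ncard : ℝ) := Finset.sum_le_sum fun b hb => hcard b (hut hb)
      _ = c * (⋃ a ∈ u, B a).ncard := by
        rw [h₂]
        push_cast
        rw [Finset.mul_sum]
  rw [ncard_sdiff hsub (htfin.subset hsub), Nat.cast_sub (ncard_le_ncard hsub htfin),
    div_mul_eq_mul_div, le_div_iff₀ (by linarith)]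
  linarith

/-- Vitali covering for `n` nested levels of finite sets `A p i`: `E p i` is an enlargement that
absorbs every set of lower level meeting a maximal `A p i`, and `T p i` is an enlargement absorbing
every set of the same level meeting `A p i` and not exceeding it in size `δ`. -/
theorem exists_disjoint_maximal_family {ι α : Type*} {X : Set ι} (hX : X.Finite) (n : ℕ)
    (A E T : ι → ℕ → Set α) (δ : ι → ℕ → ℕ) {c : ℝ} (hc : 1 ≤ c)
    (hne : ∀ p ∈ X, ∀ i < n, (A p i).Nonempty) (hfin : ∀ p ∈ X, ∀ i < n, (A p i).Finite)
    (hmono : ∀ p ∈ X, ∀ i j, i ≤ j → j < n → A p i ⊆ A p j)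
    (hAE : ∀ p ∈ X, ∀ i < n, A p i ⊆ E p i)
    (hE : ∀ p ∈ X, ∀ q ∈ X, ∀ i j, i < j → j < n →
      (∀ p' ∈ X, A q j ⊆ A p' j → A p' j = A q j) →
      (A q j ∩ A p i).Nonempty → A p i ⊆ E q j)
    (hTfin : ∀ p ∈ X, ∀ i < n, (T p i).Finite)
    (hT : ∀ p ∈ X, ∀ q ∈ X, ∀ i < n, (A q i ∩ A p i).Nonempty → δ p i ≤ δ q i → A p i ⊆ T q i)
    (hcard : ∀ p ∈ X, ∀ i < n, ((T p i).ncard : ℝ) ≤ c * (A p i).ncard) :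
    ∃ 𝒞 : Finset (ι × ℕ),
      (∀ b ∈ 𝒞, b.1 ∈ X ∧ b.2 < n) ∧
      (∀ b ∈ 𝒞, ∀ p ∈ X, A b.1 b.2 ⊆ A p b.2 → A p b.2 = A b.1 b.2) ∧
      (𝒞 : Set (ι × ℕ)).PairwiseDisjoint (fun b => A b.1 b.2) ∧
      (((⋃ p ∈ X, A p 0) \ ⋃ b ∈ 𝒞, E b.1 b.2).ncard : ℝ) ≤
        ((c - 1) / c) ^ n * (⋃ p ∈ X, A p (n - 1)).ncard := by
  classical
  rcases Nat.eq_zero_or_pos n with rfl | hn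
  · exact ⟨∅, by simp, by simp, by simp, by simp⟩
  have hθ : 0 ≤ (c - 1) / c := div_nonneg (by linarith) (by linarith)
  have key : ∀ k ≤ n, ∃ 𝒞 : Finset (ι × ℕ), ∃ Q : Set α,
      (∀ b ∈ 𝒞, b.1 ∈ X ∧ n - k ≤ b.2 ∧ b.2 < n) ∧
      (∀ b ∈ 𝒞, ∀ p ∈ X, A b.1 b.2 ⊆ A p b.2 → A p b.2 = A b.1 b.2) ∧
      (𝒞 : Set (ι × ℕ)).PairwiseDisjoint (fun b => A b.1 b.2) ∧
      Q.Finite ∧ (Q.ncard : ℝ) ≤ ((c - 1) / c) ^ k * (⋃ p ∈ X, A p (n - 1)).ncard ∧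
      ∀ p ∈ X, ∀ i < n, i ≤ n - k → (∀ b ∈ 𝒞, ¬ A p i ⊆ E b.1 b.2) →
        A p i \ (⋃ b ∈ 𝒞, A b.1 b.2) ⊆ Q := by
    intro k
    induction k with
    | zero =>
      intro _
      refine ⟨∅, ⋃ p ∈ X, A p (n - 1), by simp, by simp, by simp,
        hX.biUnion fun p hp => hfin p hp _ (by omega), by simp, ?_⟩
      intro p hp i hi _ _
      exact sdiff_subset.trans ((hmono p hp i (n - 1) (by omega) (by omega)).trans
        (subset_biUnion_of_mem (u := fun p => A p (n - 1)) hp))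
    | succ k ih =>
      intro hk
      obtain ⟨𝒞, Q, h𝒞, hmax, hdisj, hQfin, hQcard, hQ⟩ := ih (by omega)
      obtain ⟨j, hj⟩ : ∃ j, j = n - (k + 1) := ⟨_, rfl⟩
      have hjn : j < n := by omega
      let t : Finset ι := hX.toFinset.filter fun p =>
        (∀ q ∈ X, A p j ⊆ A q j → A q j = A p j) ∧ ∀ b ∈ 𝒞, ¬ A p j ⊆ E b.1 b.2
      have ht : ∀ p, p ∈ t ↔ p ∈ X ∧ (∀ q ∈ X, A p j ⊆ A q j → A q j = A p j) ∧
          ∀ b ∈ 𝒞, ¬ A p j ⊆ E b.1 b.2 := fun p => by simp [t]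
      have htX : ∀ p ∈ t, p ∈ X := fun p hp => ((ht p).1 hp).1
      have hmeet : ∀ p ∈ t, ∀ b ∈ 𝒞, Disjoint (A b.1 b.2) (A p j) := by
        intro p hp b hb
        rw [Set.disjoint_iff_inter_eq_empty, ← Set.not_nonempty_iff_eq_empty]
        intro h
        have := h𝒞 b hb
        exact ((ht p).1 hp).2.2 b hb
          (hE p (htX p hp) b.1 this.1 j b.2 (by omega) this.2.2 (hmax b hb) h)
      obtain ⟨u, hut, hudisj, hu⟩ := exists_disjoint_subfamily_ncard_diff_le
        (fun p => A p j) (fun p => T p j) (fun p => δ p j) hc t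
        (fun p hp => hne p (htX p hp) j hjn) (fun p hp => hfin p (htX p hp) j hjn)
        (fun p hp => hTfin p (htX p hp) j hjn)
        (fun p hp q hq => hT p (htX p hp) q (htX q hq) j hjn)
        (fun p hp => hcard p (htX p hp) j hjn)
      have htQ : (⋃ p ∈ t, A p j) ⊆ Q := by
        refine iUnion₂_subset fun p hp => ?_
        refine Subset.trans ?_ (hQ p (htX p hp) j hjn (by omega) ((ht p).1 hp).2.2)
        refine subset_sdiff.2 ⟨Subset.rfl, ?_⟩
        exact (disjoint_iUnion₂_left.2 fun b hb => hmeet p hp b hb).symm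
      refine ⟨𝒞 ∪ u.image fun p => (p, j), (⋃ p ∈ t, A p j) \ ⋃ p ∈ u, A p j,
        ?_, ?_, ?_, (hQfin.subset htQ).subset sdiff_subset, ?_, ?_⟩
      · intro b hb
        rcases Finset.mem_union.1 hb with hb | hb
        · have := h𝒞 b hb
          exact ⟨this.1, by omega, this.2.2⟩
        · obtain ⟨p, hp, rfl⟩ := Finset.mem_image.1 hb
          exact ⟨htX p (hut hp), hj.ge, hjn⟩
      · intro b hb
        rcases Finset.mem_union.1 hb with hb | hb
        · exact hmax b hb
        · obtain ⟨p, hp, rfl⟩ := Finset.mem_image.1 hb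
          exact ((ht p).1 (hut hp)).2.1
      · rw [Finset.coe_union, pairwiseDisjoint_union]
        refine ⟨hdisj, ?_, ?_⟩
        · rintro x hx y hy hxy
          obtain ⟨p, hp, rfl⟩ := Finset.mem_image.1 hx
          obtain ⟨q, hq, rfl⟩ := Finset.mem_image.1 hy
          exact hudisj hp hq fun h => hxy (by rw [h])
        · rintro b hb y hy _
          obtain ⟨q, hq, rfl⟩ := Finset.mem_image.1 hy
          exact hmeet q (hut hq) b hb
      · have h₁ : ((⋃ p ∈ t, A p j).ncard : ℝ) ≤ Q.ncard := by
          exact_mod_cast ncard_le_ncard htQ hQfin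
        calc _ ≤ (c - 1) / c * ((⋃ p ∈ t, A p j).ncard : ℝ) := hu
          _ ≤ (c - 1) / c * (((c - 1) / c) ^ k * (⋃ p ∈ X, A p (n - 1)).ncard) :=
            mul_le_mul_of_nonneg_left (h₁.trans hQcard) hθ
          _ = _ := by ring
      · intro p hp i hi hij hnot
        obtain ⟨M, hpM, ⟨⟨q, hq, rfl⟩, hqmax⟩⟩ :=
          (hX.image fun p => A p j).exists_le_maximal (mem_image_of_mem _ hp)
        have hsub : A p i ⊆ A q j := (hmono p hp i j (by omega) hjn).trans hpM
        have hqt : q ∈ t := (ht q).2 ⟨hq,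
          fun q' hq' h => (hqmax (mem_image_of_mem _ hq') h).antisymm h,
          fun b hb h => hnot b (Finset.mem_union_left _ hb) (hsub.trans h)⟩
        refine sdiff_subset_sdiff (hsub.trans (subset_biUnion_of_mem (u := fun p => A p j) hqt)) ?_
        refine iUnion₂_subset fun a ha => ?_
        exact subset_biUnion_of_mem (u := fun b : ι × ℕ => A b.1 b.2)
          (Finset.mem_union_right 𝒞 (Finset.mem_image_of_mem (fun p => (p, j)) ha))
  obtain ⟨𝒞, Q, h𝒞, hmax, hdisj, hQfin, hQcard, hQ⟩ := key n le_rfl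
  refine ⟨𝒞, fun b hb => ⟨(h𝒞 b hb).1, (h𝒞 b hb).2.2⟩, hmax, hdisj, le_trans ?_ hQcard⟩
  refine Nat.cast_le.2 (ncard_le_ncard ?_ hQfin)
  rintro x ⟨hx, hxE⟩
  obtain ⟨p, hp, hxp⟩ := mem_iUnion₂.1 hx
  have hxE' : ∀ b ∈ 𝒞, x ∉ E b.1 b.2 := fun b hb h => hxE (mem_iUnion₂.2 ⟨b, hb, h⟩)
  refine hQ p hp 0 hn (Nat.zero_le _) (fun b hb h => hxE' b hb (h hxp)) ⟨hxp, fun h => ?_⟩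
  obtain ⟨b, hb, hxb⟩ := mem_iUnion₂.1 h
  exact hxE' b hb (hAE b.1 (h𝒞 b hb).1 b.2 (h𝒞 b hb).2.2 hxb)

/-- Corollary of the effective Vitali covering theorem: if moreover `|Sₙ| ≤ (c+1)|S₁|`,
then the `(1+4/(r-2))`-enlargements of a disjoint subcollection of maximal balls cover at
least a `(1 - (c+1)((c-1)/c)ⁿ)`-fraction of `S₁`. -/
theorem effective_vitali_corollary (S : Finset Γ) (hS : Subgroup.closure (S : Set Γ) = ⊤)
    (d : ℕ) (C : ℝ) (hC : 1 ≤ C)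
    (hgr : ∀ m : ℕ, 1 ≤ m →
      (1 / C) * (m : ℝ) ^ d ≤ ((wordBall S 1 (m : ℝ)).ncard : ℝ) ∧
      ((wordBall S 1 (m : ℝ)).ncard : ℝ) ≤ C * (m : ℝ) ^ d)
    (R n r : ℕ) (hR : 2 < R) (hn : 2 < n) (hr : 2 < r)
    (X : Set Γ) (hX : X ⊆ wordBall S 1 (R : ℝ))
    (ctr : Γ → ℕ → Γ) (rad : Γ → ℕ → ℝ)
    (hmem : ∀ p ∈ X, ∀ i < n, p ∈ wordBall S (ctr p i) (rad p i))
    (hsub : ∀ p ∈ X, ∀ i < n, wordBall S (ctr p i) (rad p i) ⊆ wordBall S 1 (R : ℝ))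
    (hnest : ∀ p ∈ X, ∀ i, i + 1 < n →
      wordBall S (ctr p i) ((r : ℝ) * rad p i) ⊆ wordBall S (ctr p (i + 1)) (rad p (i + 1)))
    (hSn : (((⋃ p ∈ X, wordBall S (ctr p (n - 1)) (rad p (n - 1))).ncard : ℝ)) ≤
      (3 ^ d * C ^ 2 + 1) * (((⋃ p ∈ X, wordBall S (ctr p 0) (rad p 0)).ncard : ℝ))) :
    ∃ 𝒞 : Finset (Γ × ℕ),
      (∀ c ∈ 𝒞, c.1 ∈ X ∧ c.2 < n) ∧
      -- the balls in 𝒞 are maximal balls of their level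
      (∀ c ∈ 𝒞, ∀ p ∈ X,
        wordBall S (ctr c.1 c.2) (rad c.1 c.2) ⊆ wordBall S (ctr p c.2) (rad p c.2) →
        wordBall S (ctr p c.2) (rad p c.2) = wordBall S (ctr c.1 c.2) (rad c.1 c.2)) ∧
      Set.Pairwise (↑𝒞) (Function.onFun Disjoint
        fun c : Γ × ℕ => wordBall S (ctr c.1 c.2) (rad c.1 c.2)) ∧
      (1 - (3 ^ d * C ^ 2 + 1) * ((3 ^ d * C ^ 2 - 1) / (3 ^ d * C ^ 2)) ^ n) *
          (((⋃ p ∈ X, wordBall S (ctr p 0) (rad p 0)).ncard : ℝ)) ≤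
        (((⋃ p ∈ X, wordBall S (ctr p 0) (rad p 0)) ∩
          (⋃ c ∈ 𝒞, wordBall S (ctr c.1 c.2) ((1 + 4 / ((r : ℝ) - 2)) * rad c.1 c.2))).ncard : ℝ) := by
  have hc : (1 : ℝ) ≤ 3 ^ d * C ^ 2 :=
    one_le_mul_of_one_le_of_one_le (one_le_pow₀ (by norm_num)) (one_le_pow₀ hC)
  have hballfin : ∀ (x : Γ) (m : ℕ), 1 ≤ m → (wordBall S x (m : ℝ)).Finite := by
    intro x m hm
    refine finite_of_ncard_pos ?_
    rw [ncard_wordBall]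
    have hm' : (0 : ℝ) < m := by exact_mod_cast hm
    exact_mod_cast lt_of_lt_of_le (by positivity : (0 : ℝ) < 1 / C * (m : ℝ) ^ d) (hgr m hm).1
  have hRfin : (wordBall S 1 (R : ℝ)).Finite := hballfin 1 R (by omega)
  have hrad : ∀ p ∈ X, ∀ i < n, 0 ≤ rad p i := fun p hp i hi =>
    radius_nonneg_of_mem_wordBall (hmem p hp i hi)
  have hr' : (0 : ℝ) < (r : ℝ) - 2 := by
    have : (2 : ℝ) < r := by exact_mod_cast hr
    linarith
  have hmono : ∀ p ∈ X, ∀ i j, i ≤ j → j < n →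
      wordBall S (ctr p i) (rad p i) ⊆ wordBall S (ctr p j) (rad p j) := by
    intro p hp i j hij
    induction j, hij using Nat.le_induction with
    | base => exact fun _ => Subset.rfl
    | succ j hij ih =>
      intro hj
      refine (ih (by omega)).trans ((wordBall_mono S _ ?_).trans (hnest p hp j hj))
      exact le_mul_of_one_le_left (hrad p hp j (by omega)) (by linarith)
  have hA_subset : ∀ p ∈ X, ∀ i < n, wordBall S (ctr p i) (rad p i) ⊆
      wordBall S (ctr p i) ((1 + 4 / ((r : ℝ) - 2)) * rad p i) := fun p hp i hi =>
    wordBall_mono S _ (le_mul_of_one_le_left (hrad p hp i hi)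
      (le_add_of_nonneg_right (by positivity)))
  obtain ⟨𝒞, h𝒞, hmax, hdisj, hcover⟩ := exists_disjoint_maximal_family (hRfin.subset hX) n
    (fun p i => wordBall S (ctr p i) (rad p i))
    (fun p i => wordBall S (ctr p i) ((1 + 4 / ((r : ℝ) - 2)) * rad p i))
    (fun p i => wordBall S (ctr p i) ((3 * ⌊rad p i⌋₊ : ℕ) : ℝ))
    (fun p i => ⌊rad p i⌋₊) hc (fun p hp i hi => ⟨p, hmem p hp i hi⟩)
    (fun p hp i hi => hRfin.subset (hsub p hp i hi)) hmono hA_subset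
    (by
      intro p hp q hq i j hij hj hqmax hmeet
      rcases le_total (((r : ℝ) - 2) * rad p i) (2 * rad q j) with h | h
      · refine wordBall_subset_of_inter_nonempty hS hmeet ?_
        have : rad p i ≤ 2 * rad q j / ((r : ℝ) - 2) := by
          rw [le_div_iff₀ hr']
          linarith
        calc rad q j + 2 * rad p i ≤ rad q j + 2 * (2 * rad q j / ((r : ℝ) - 2)) := by gcongr
          _ = _ := by ring
      · have hrp : wordBall S (ctr p i) ((r : ℝ) * rad p i) ⊆
            wordBall S (ctr p j) (rad p j) :=
          (hnest p hp i (by omega)).trans (hmono p hp (i + 1) j hij hj)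
        have hqp : wordBall S (ctr q j) (rad q j) ⊆ wordBall S (ctr p j) (rad p j) :=
          (wordBall_subset_of_inter_nonempty hS (inter_comm _ _ ▸ hmeet)
            (by linarith [hrad p hp i (by omega)])).trans hrp
        exact (hmono p hp i j hij.le hj).trans
          ((hqmax p hp hqp).subset.trans (hA_subset q hq j hj)))
    (by
      intro p hp i hi
      rcases Nat.eq_zero_or_pos ⌊rad p i⌋₊ with h | h
      · have := wordBall_natFloor S (ctr p i) (hrad p hp i hi)
        rw [h] at this ⊢
        rw [mul_zero, this]
        exact hRfin.subset (hsub p hp i hi)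
      · exact hballfin _ _ (by omega))
    (by
      intro p hp q hq i hi hmeet hle
      have hle' : (⌊rad p i⌋₊ : ℝ) ≤ ⌊rad q i⌋₊ := by exact_mod_cast hle
      simp only [← wordBall_natFloor S _ (hrad p hp i hi),
        ← wordBall_natFloor S _ (hrad q hq i hi)] at hmeet ⊢
      refine wordBall_subset_of_inter_nonempty hS hmeet ?_
      push_cast
      linarith)
    (by
      intro p hp i hi
      simp only [← wordBall_natFloor S _ (hrad p hp i hi)]
      simpa using ncard_wordBall_three_mul_le hC hgr (ctr p i) ⌊rad p i⌋₊)
  refine ⟨𝒞, h𝒞, hmax, hdisj, ?_⟩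
  have hfin : (⋃ p ∈ X, wordBall S (ctr p 0) (rad p 0)).Finite :=
    hRfin.subset (iUnion₂_subset fun p hp => hsub p hp 0 (by omega))
  have hsplit := ncard_inter_add_ncard_sdiff_eq_ncard (⋃ p ∈ X, wordBall S (ctr p 0) (rad p 0))
    (⋃ c ∈ 𝒞, wordBall S (ctr c.1 c.2) ((1 + 4 / ((r : ℝ) - 2)) * rad c.1 c.2)) hfin
  rw [← @Nat.cast_inj ℝ, Nat.cast_add] at hsplit
  have hθ : (0 : ℝ) ≤ ((3 ^ d * C ^ 2 - 1) / (3 ^ d * C ^ 2)) ^ n :=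
    pow_nonneg (div_nonneg (by linarith) (by linarith)) n
  have := mul_le_mul_of_nonneg_left hSn hθ
  linarith
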